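/- For x, y ∈ ℍ, the determinant of the matrix M(x) + i·M(y) ∈ M₂(ℂ) equals ‖x‖² - ‖y‖² + 2i⟨x,y⟩, where ⟨x,y⟩ = Re(conj(x)·y) is the standard real inner product on ℍ. -/

import Mathlib

open Quaternion Matrix

/-- The standard embedding `ℍ → M₂(ℂ)`, `q = α + kβ ↦ [[α, -conj β], [β, conj α]]`. -/
noncomputable def quatToMatrix (q : Quaternion ℝ) : Matrix (Fin 2) (Fin 2) ℂ :=
  !![Complex.mk q.re q.imI, -(starRingEnd ℂ) (Complex.mk q.imK q.imJ);
     Complex.mk q.imK q.imJ, (starRingEnd ℂ) (Complex.mk q.re q.imI)]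

/-- `det (M(x) + i·M(y)) = ‖x‖² - ‖y‖² + 2i⟨x, y⟩` where `⟨x, y⟩ = Re(conj(x)·y)`. -/
theorem det_pair (x y : Quaternion ℝ) :
    (quatToMatrix x + Complex.I • quatToMatrix y).det =
      ((‖x‖ ^ 2 - ‖y‖ ^ 2 : ℝ) : ℂ) + 2 * Complex.I * (((star x * y).re : ℝ) : ℂ) := by
  have norm_sq (q : Quaternion ℝ) : ‖q‖ ^ 2 = q.re ^ 2 + q.imI ^ 2 + q.imJ ^ 2 + q.imK ^ 2 := by
    rw [← Quaternion.normSq_def', Quaternion.normSq_eq_norm_mul_self, sq]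
  rw [norm_sq, norm_sq, Matrix.det_fin_two]
  apply Complex.ext <;> simp [quatToMatrix, sq] <;> ring
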